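/- Let m ≥ 1, let a₀, a₁, …, a_m and n be positive natural numbers, and for each k = 1, …, m let U_k be an a_{k−1}×a_k real matrix with orthonormal columns (U_kᵀU_k = I), let W_k be an a_k×n real matrix, and let E_k = W_{k−1} − U_k W_k be the residual, where W₀ is a given a₀×n real matrix. Suppose U_kᵀ E_k = 0 for every k. Then ‖W₀ − U₁ U₂ ⋯ U_m W_m‖_F² = ∑_{k=1}^{m} ‖E_k‖_F². -/

import Mathlib

open Matrix

/-- The Frobenius norm of a real matrix: `sqrt (∑ i j, M i j ^ 2)`. -/
noncomputable def frobNorm {p q : ℕ} (M : Matrix (Fin p) (Fin q) ℝ) : ℝ :=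
  Real.sqrt (∑ i, ∑ j, (M i j) ^ 2)

theorem frobNorm_sq_eq_trace {p q : ℕ} (M : Matrix (Fin p) (Fin q) ℝ) :
    frobNorm M ^ 2 = (Mᵀ * M).trace := by
  rw [frobNorm, Real.sq_sqrt (by positivity), Finset.sum_comm]
  simp [Matrix.trace, Matrix.mul_apply, sq]

/-- Pythagoras: if the columns of `P` are orthonormal and orthogonal to those of `D`, then
`‖D + P E‖_F² = ‖D‖_F² + ‖E‖_F²`. -/
theorem frobNorm_add_mul_sq {p q n : ℕ} {D : Matrix (Fin p) (Fin n) ℝ}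
    {P : Matrix (Fin p) (Fin q) ℝ} (E : Matrix (Fin q) (Fin n) ℝ)
    (hP : Pᵀ * P = 1) (hPD : Pᵀ * D = 0) :
    frobNorm (D + P * E) ^ 2 = frobNorm D ^ 2 + frobNorm E ^ 2 := by
  have hDP : Dᵀ * P = 0 := by simpa using congrArg Matrix.transpose hPD
  have h : (D + P * E)ᵀ * (D + P * E) = Dᵀ * D + Eᵀ * E := by
    calc (D + P * E)ᵀ * (D + P * E)
        = Dᵀ * D + Dᵀ * P * E + Eᵀ * (Pᵀ * D) + Eᵀ * (Pᵀ * P) * E := by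
          simp only [Matrix.transpose_add, Matrix.transpose_mul, Matrix.add_mul,
            Matrix.mul_add, Matrix.mul_assoc]
          abel
      _ = Dᵀ * D + Eᵀ * E := by simp [hDP, hPD, hP]
  simp only [frobNorm_sq_eq_trace, h, Matrix.trace_add]

theorem Fin.apply_last_eq_add_sum {α : Type*} [AddCommMonoid α] {m : ℕ}
    (f : Fin (m + 1) → α) (g : Fin m → α)
    (h : ∀ k : Fin m, f k.succ = f k.castSucc + g k) :
    f (Fin.last m) = f 0 + ∑ k, g k := by
  induction m with
  | zero => simp
  | succ m ih =>
    have h' := ih (fun k => f k.castSucc) (fun k => g k.castSucc) fun k => h k.castSucc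
    rw [Fin.sum_univ_castSucc, ← add_assoc, ← Fin.succ_last, h]
    exact congrArg (· + g (Fin.last m)) h'

/-- Telescoping identity for repeated orthonormal peeling: if
`E_k = W_{k-1} − U_k W_k` with `U_kᵀ U_k = 1` and `U_kᵀ E_k = 0` for every `k`,
and `P_k = U_1 ⋯ U_k` denotes the partial products (`P_0 = 1`,
`P_{k+1} = P_k U_{k+1}`), then
`‖W_0 − U_1 ⋯ U_m W_m‖_F² = ∑_{k=1}^m ‖E_k‖_F²`. -/
theorem frobNorm_sq_telescoping_peeling
    (m n : ℕ) (hm : 1 ≤ m) (a : Fin (m + 1) → ℕ)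
    (ha : ∀ k, 0 < a k) (hn : 0 < n)
    (U : (k : Fin m) → Matrix (Fin (a k.castSucc)) (Fin (a k.succ)) ℝ)
    (W : (k : Fin (m + 1)) → Matrix (Fin (a k)) (Fin n) ℝ)
    (E : (k : Fin m) → Matrix (Fin (a k.castSucc)) (Fin n) ℝ)
    (hE : ∀ k, E k = W k.castSucc - U k * W k.succ)
    (hUU : ∀ k, (U k)ᵀ * U k = 1)
    (hUE : ∀ k, (U k)ᵀ * E k = 0)
    (P : (k : Fin (m + 1)) → Matrix (Fin (a 0)) (Fin (a k)) ℝ)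
    (hP0 : P 0 = 1)
    (hPsucc : ∀ k : Fin m, P k.succ = P k.castSucc * U k) :
    frobNorm (W 0 - P (Fin.last m) * W (Fin.last m)) ^ 2 =
      ∑ k : Fin m, frobNorm (E k) ^ 2 := by
  have hstep (k : Fin m) : W 0 - P k.succ * W k.succ =
      (W 0 - P k.castSucc * W k.castSucc) + P k.castSucc * E k := by
    rw [hE, hPsucc, Matrix.mul_sub, Matrix.mul_assoc]
    abel
  have hPP (k : Fin (m + 1)) : (P k)ᵀ * P k = 1 := by
    induction k using Fin.induction with
    | zero => simp [hP0]
    | succ k ih =>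
      rw [hPsucc, Matrix.transpose_mul, Matrix.mul_assoc, ← Matrix.mul_assoc _ _ (U k), ih,
        Matrix.one_mul, hUU]
  have hPD (k : Fin (m + 1)) : (P k)ᵀ * (W 0 - P k * W k) = 0 := by
    induction k using Fin.induction with
    | zero => simp [hP0]
    | succ k ih =>
      rw [hstep, hPsucc, Matrix.transpose_mul, Matrix.mul_assoc, Matrix.mul_add, ih,
        ← Matrix.mul_assoc _ _ (E k), hPP, Matrix.one_mul, zero_add, hUE]
  have htel := Fin.apply_last_eq_add_sum (fun k => frobNorm (W 0 - P k * W k) ^ 2)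
    (fun k => frobNorm (E k) ^ 2) fun k => by
      simpa only [hstep] using frobNorm_add_mul_sq (E k) (hPP k.castSucc) (hPD k.castSucc)
  simpa [hP0, frobNorm] using htel
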